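/- Let B be the unit ball in ℝ³ and suppose u ∈ C¹(cl B, ℝ³) satisfies rot u = 0, div u = 0 in B. If additionally n·u = 0 on ∂B, then u = 0 in B. (Equivalently, the space B_H of harmonic fields with vanishing normal trace on a simply connected smooth domain is trivial.) -/

import Mathlib

open MeasureTheory

noncomputable section

def pd (i : Fin 3) (f : (Fin 3 → ℝ) → ℝ) (x : Fin 3 → ℝ) : ℝ :=
  fderiv ℝ f x (Pi.single i 1)

def grad3 (h : (Fin 3 → ℝ) → ℝ) (x : Fin 3 → ℝ) : Fin 3 → ℝ := fun i => pd i h x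

def div3 (u : (Fin 3 → ℝ) → (Fin 3 → ℝ)) (x : Fin 3 → ℝ) : ℝ :=
  ∑ i, pd i (fun y => u y i) x

def rot3 (u : (Fin 3 → ℝ) → (Fin 3 → ℝ)) (x : Fin 3 → ℝ) : Fin 3 → ℝ :=
  ![pd 1 (fun y => u y 2) x - pd 2 (fun y => u y 1) x,
    pd 2 (fun y => u y 0) x - pd 0 (fun y => u y 2) x,
    pd 0 (fun y => u y 1) x - pd 1 (fun y => u y 0) x]

def dot3 (a b : Fin 3 → ℝ) : ℝ := ∑ i, a i * b i

/-- The open Euclidean ball of radius \`R\` centred at the origin in \`ℝ³\`. -/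
def ball3 (R : ℝ) : Set (Fin 3 → ℝ) := {x | dot3 x x < R ^ 2}

open Filter Topology

lemma dot3_eq (a b : Fin 3 → ℝ) : dot3 a b = a 0 * b 0 + a 1 * b 1 + a 2 * b 2 := by
  simp [dot3, Fin.sum_univ_three]

lemma dot3_smul_smul (t : ℝ) (a b : Fin 3 → ℝ) : dot3 (t • a) (t • b) = t ^ 2 * dot3 a b := by
  simp [dot3_eq]; ring

lemma dot3_smul_left (t : ℝ) (a b : Fin 3 → ℝ) : dot3 (t • a) b = t * dot3 a b := by
  simp [dot3_eq]; ring

lemma dot3_self_nonneg (a : Fin 3 → ℝ) : 0 ≤ dot3 a a := by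
  rw [dot3_eq]; nlinarith [sq_nonneg (a 0), sq_nonneg (a 1), sq_nonneg (a 2)]

lemma continuous_dot3_self : Continuous fun x : Fin 3 → ℝ => dot3 x x := by
  unfold dot3; fun_prop

lemma isCompact_dot3_self_le (s : ℝ) : IsCompact {x : Fin 3 → ℝ | dot3 x x ≤ s} := by
  refine Metric.isCompact_of_isClosed_isBounded
    (isClosed_le continuous_dot3_self continuous_const) ?_
  refine (Metric.isBounded_closedBall (x := (0 : Fin 3 → ℝ)) (r := √s)).subset fun x hx => ?_
  rw [mem_closedBall_zero_iff, pi_norm_le_iff_of_nonneg (Real.sqrt_nonneg _)]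
  intro i
  refine Real.abs_le_sqrt ?_
  simp only [Set.mem_ofPred_eq, dot3_eq] at hx
  fin_cases i <;> simp <;> nlinarith [sq_nonneg (x 0), sq_nonneg (x 1), sq_nonneg (x 2)]

lemma isOpen_ball3 (R : ℝ) : IsOpen (ball3 R) :=
  isOpen_lt continuous_dot3_self continuous_const

lemma convex_ball3 (R : ℝ) : Convex ℝ (ball3 R) := by
  intro x hx y hy a b ha hb hab
  simp only [ball3, Set.mem_ofPred_eq] at *
  have h : dot3 (a • x + b • y) (a • x + b • y)
      = a * dot3 x x + b * dot3 y y - a * b * dot3 (x - y) (x - y) := by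
    obtain rfl : b = 1 - a := by linarith
    simp [dot3_eq]; ring
  have := mul_nonneg (mul_nonneg ha hb) (dot3_self_nonneg (x - y))
  rcases ha.eq_or_lt with rfl | ha'
  · obtain rfl : b = 1 := by linarith
    linarith
  · nlinarith [mul_lt_mul_of_pos_left hx ha', mul_le_mul_of_nonneg_left hy.le hb]

/-- The continuous linear form `y ↦ dot3 v y`, depending linearly on `v`. -/
def dot3L : (Fin 3 → ℝ) →L[ℝ] (Fin 3 → ℝ) →L[ℝ] ℝ :=
  ∑ i, (ContinuousLinearMap.proj i).smulRight
    (ContinuousLinearMap.proj i : (Fin 3 → ℝ) →L[ℝ] ℝ)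

lemma dot3L_apply (v y : Fin 3 → ℝ) : dot3L v y = dot3 v y := by
  simp [dot3L, dot3]

lemma hasFDerivAt_dot3_self (x : Fin 3 → ℝ) :
    HasFDerivAt (fun x : Fin 3 → ℝ => dot3 x x) (dot3L ((2 : ℝ) • x)) x := by
  have h := (dot3L.hasFDerivAt (x := x)).clm_apply (hasFDerivAt_id x)
  simp only [dot3L_apply, id] at h
  refine h.congr_fderiv ?_
  ext1 y
  simp [dot3L_apply, dot3_eq]
  ring

lemma second_deriv_nonpos_of_isLocalMax {f f' : ℝ → ℝ} {a c : ℝ}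
    (hf : ∀ᶠ t in 𝓝 a, HasDerivAt f (f' t) t) (hf' : HasDerivAt f' c a)
    (hmax : IsLocalMax f a) : c ≤ 0 := by
  by_contra! hc
  have hd : deriv f =ᶠ[𝓝 a] f' := hf.mono fun t ht => ht.deriv
  have hmin : IsLocalMin f a := isLocalMin_of_deriv_deriv_pos
    (by rw [hd.deriv_eq, hf'.deriv]; exact hc) hmax.deriv_eq_zero hf.self_of_nhds.continuousAt
  have hconst : f =ᶠ[𝓝 a] fun _ => f a := by
    filter_upwards [hmin, hmax] with t h1 h2 using le_antisymm h2 h1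
  have h0 : deriv f =ᶠ[𝓝 a] fun _ => 0 := by
    simpa using hconst.deriv
  have := (hd.symm.trans h0).deriv_eq
  rw [hf'.deriv] at this
  simp at this
  linarith

/-- Weak maximum principle on a closed ball for a function with divergence-free gradient. -/
lemma le_of_div_grad_eq_zero {g : (Fin 3 → ℝ) → ℝ} {G : (Fin 3 → ℝ) → Fin 3 → ℝ}
    {G' : (Fin 3 → ℝ) → (Fin 3 → ℝ) →L[ℝ] (Fin 3 → ℝ)} {s M : ℝ}
    (hc : ContinuousOn g {x | dot3 x x ≤ s})
    (hg : ∀ x, dot3 x x < s → HasFDerivAt g (dot3L (G x)) x)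
    (hG : ∀ x, dot3 x x < s → HasFDerivAt G (G' x) x)
    (hdiv : ∀ x, dot3 x x < s → ∑ i, G' x (Pi.single i 1) i = 0)
    (hM : ∀ x, dot3 x x = s → g x ≤ M) {x : Fin 3 → ℝ} (hx : dot3 x x ≤ s) : g x ≤ M := by
  by_contra! hlt
  have hs : 0 ≤ s := (dot3_self_nonneg x).trans hx
  obtain ⟨δ, hδ, hδs⟩ : ∃ δ > 0, δ * s < g x - M := by
    refine ⟨(g x - M) / (s + 1), div_pos (by linarith) (by linarith), ?_⟩
    rw [div_mul_eq_mul_div, div_lt_iff₀ (by linarith)]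
    nlinarith
  obtain ⟨p, hp, hpmax⟩ := (isCompact_dot3_self_le s).exists_isMaxOn ⟨x, hx⟩
    (hc.add (continuous_dot3_self.const_smul δ).continuousOn)
  have hxp := hpmax hx
  simp only [Set.mem_ofPred_eq, Pi.add_apply, Pi.smul_apply, smul_eq_mul] at hxp hp
  have hps : dot3 p p < s := by
    refine lt_of_le_of_ne hp fun h => ?_
    have := hM p h
    rw [h] at hxp
    nlinarith [mul_nonneg hδ.le (dot3_self_nonneg x)]
  have hopen : IsOpen {x : Fin 3 → ℝ | dot3 x x < s} :=
    isOpen_lt continuous_dot3_self continuous_const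
  have key : ∀ i : Fin 3, G' p (Pi.single i 1) i + 2 * δ ≤ 0 := by
    intro i
    set e : Fin 3 → ℝ := Pi.single i 1 with he
    have hline : ∀ t : ℝ, HasDerivAt (fun t : ℝ => p + t • e) e t := fun t => by
      simpa using ((hasDerivAt_id t).smul_const e).const_add p
    have hcont : ContinuousAt (fun t : ℝ => p + t • e) 0 := (hline 0).continuousAt
    have hnear : ∀ᶠ t : ℝ in 𝓝 0, dot3 (p + t • e) (p + t • e) < s :=
      hcont.eventually_mem (hopen.mem_nhds (by simpa using hps))
    have hei : ∀ v, dot3 v e = v i := fun v => by simp [dot3, he, Pi.single_apply]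
    refine second_deriv_nonpos_of_isLocalMax (a := 0)
      (f := fun t => g (p + t • e) + δ * dot3 (p + t • e) (p + t • e))
      (f' := fun t => G (p + t • e) i + δ * (2 * (p + t • e) i)) ?_ ?_ ?_
    · filter_upwards [hnear] with t ht
      have h1 := (hg _ ht).comp_hasDerivAt t (hline t)
      have h2 := ((hasFDerivAt_dot3_self (p + t • e)).comp_hasDerivAt t (hline t)).const_mul δ
      refine (h1.add h2).congr_deriv ?_
      simp only [dot3L_apply, hei, Pi.smul_apply, smul_eq_mul]
    · have hG0 : HasFDerivAt G (G' p) (p + (0 : ℝ) • e) := by simpa using hG p hps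
      have h1 := hasDerivAt_pi.1 (hG0.comp_hasDerivAt 0 (hline 0)) i
      have h2 := ((hasDerivAt_pi.1 (hline 0) i).const_mul 2).const_mul δ
      refine (h1.add h2).congr_deriv ?_
      simp [he]; ring
    · filter_upwards [hnear] with t ht
      simpa using hpmax (show p + t • e ∈ {x | dot3 x x ≤ s} from ht.le)
  have := hdiv p hps
  rw [Fin.sum_univ_three] at this
  linarith [key 0, key 1, key 2]

lemma abs_le_of_div_grad_eq_zero {g : (Fin 3 → ℝ) → ℝ} {G : (Fin 3 → ℝ) → Fin 3 → ℝ}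
    {G' : (Fin 3 → ℝ) → (Fin 3 → ℝ) →L[ℝ] (Fin 3 → ℝ)} {s M : ℝ}
    (hc : ContinuousOn g {x | dot3 x x ≤ s})
    (hg : ∀ x, dot3 x x < s → HasFDerivAt g (dot3L (G x)) x)
    (hG : ∀ x, dot3 x x < s → HasFDerivAt G (G' x) x)
    (hdiv : ∀ x, dot3 x x < s → ∑ i, G' x (Pi.single i 1) i = 0)
    (hM : ∀ x, dot3 x x = s → |g x| ≤ M) {x : Fin 3 → ℝ} (hx : dot3 x x ≤ s) : |g x| ≤ M := by
  refine abs_le'.2 ⟨le_of_div_grad_eq_zero hc hg hG hdiv (fun y hy => (abs_le'.1 (hM y hy)).1) hx,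
    le_of_div_grad_eq_zero (g := fun y => -g y) (G := fun y => -G y) (G' := fun y => -G' y)
      hc.neg (fun y hy => ?_) (fun y hy => (hG y hy).neg) (fun y hy => ?_)
      (fun y hy => (abs_le'.1 (hM y hy)).2) hx⟩
  · exact (hg y hy).neg.congr_fderiv (map_neg dot3L (G y)).symm
  · simpa using hdiv y hy

/-- A field that is continuous up to the boundary and tangential there has small radial component
near the boundary. -/
lemma exists_radial_lt {u : (Fin 3 → ℝ) → (Fin 3 → ℝ)} (hu : ContinuousOn u (closure (ball3 1)))
    (hbc : ∀ x, dot3 x x = 1 → dot3 x (u x) = 0) {ε : ℝ} (hε : 0 < ε) :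
    ∃ ρ < 1, ∀ x ∈ ball3 1, ρ < dot3 x x → |dot3 x (u x)| < ε := by
  have hsub : closure (ball3 1) ⊆ {x | dot3 x x ≤ 1} :=
    closure_minimal (fun x hx => (by simpa [ball3] using hx : dot3 x x < 1).le)
      (isClosed_le continuous_dot3_self continuous_const)
  have hcont : ContinuousOn (fun x => |dot3 x (u x)|) (closure (ball3 1)) := by
    have hui : ∀ i, ContinuousOn (fun x => u x i) (closure (ball3 1)) := continuousOn_pi.1 hu
    unfold dot3
    refine (continuousOn_finsetSum _ fun i _ => ?_).abs
    exact (continuous_apply i).continuousOn.mul (hui i)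
  have hK : IsCompact (closure (ball3 1) ∩ (fun x => |dot3 x (u x)|) ⁻¹' Set.Ici ε) :=
    (isCompact_dot3_self_le 1).of_isClosed_subset
      (hcont.preimage_isClosed_of_isClosed isClosed_closure isClosed_Ici)
      (Set.inter_subset_left.trans hsub)
  rcases (closure (ball3 1) ∩ (fun x => |dot3 x (u x)|) ⁻¹' Set.Ici ε).eq_empty_or_nonempty
    with hemp | hne
  · refine ⟨0, one_pos, fun x hx _ => ?_⟩
    by_contra! h
    exact Set.eq_empty_iff_forall_notMem.1 hemp x ⟨subset_closure hx, h⟩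
  · obtain ⟨p, ⟨hp, hpε⟩, hmax⟩ := hK.exists_isMaxOn hne continuous_dot3_self.continuousOn
    refine ⟨dot3 p p, lt_of_le_of_ne (hsub hp) fun h => ?_, fun x hx hlt => ?_⟩
    · simp only [Set.mem_preimage, hbc p h, abs_zero, Set.mem_Ici] at hpε
      linarith
    · by_contra! h
      exact hlt.not_ge (hmax ⟨subset_closure hx, h⟩)

lemma hasDerivAt_radial {φ : (Fin 3 → ℝ) → ℝ} {v x : Fin 3 → ℝ} {t : ℝ}
    (h : HasFDerivAt φ (dot3L v) (t • x)) : HasDerivAt (fun t : ℝ => φ (t • x)) (dot3 x v) t := by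
  have := h.comp_hasDerivAt t (by simpa using (hasDerivAt_id t).smul_const x :
    HasDerivAt (fun t : ℝ => t • x) x t)
  exact this.congr_deriv (by simp [dot3L_apply, dot3, mul_comm])

lemma pd_apply {u : (Fin 3 → ℝ) → (Fin 3 → ℝ)} {x : Fin 3 → ℝ} (h : DifferentiableAt ℝ u x)
    (i j : Fin 3) : pd i (fun y => u y j) x = fderiv ℝ u x (Pi.single i 1) j := by
  rw [pd, (hasFDerivAt_pi'.1 h.hasFDerivAt j).fderiv]
  rfl

lemma exists_potential {u : (Fin 3 → ℝ) → (Fin 3 → ℝ)} (hd : ∀ x ∈ ball3 1, DifferentiableAt ℝ u x)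
    (hrot : ∀ x ∈ ball3 1, rot3 u x = 0) :
    ∃ φ : (Fin 3 → ℝ) → ℝ, ∀ x ∈ ball3 1, HasFDerivAt φ (dot3L (u x)) x := by
  have hω : ∀ x ∈ ball3 1, HasFDerivAt (fun x => dot3L (u x)) (dot3L.comp (fderiv ℝ u x)) x :=
    fun x hx => dot3L.hasFDerivAt.comp x (hd x hx).hasFDerivAt
  refine (convex_ball3 1).exists_forall_hasFDerivAt_of_fderiv_symmetric (isOpen_ball3 1)
    (fun x hx => (hω x hx).differentiableAt.differentiableWithinAt) fun x hx a b => ?_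
  rw [(hω x hx).fderiv]
  have hr := hrot x hx
  simp only [rot3, pd_apply (hd x hx)] at hr
  have h0 := congrFun hr 0
  have h1 := congrFun hr 1
  have h2 := congrFun hr 2
  simp at h0 h1 h2
  have hdec : ∀ a : Fin 3 → ℝ, fderiv ℝ u x a = a 0 • fderiv ℝ u x (Pi.single 0 1)
      + a 1 • fderiv ℝ u x (Pi.single 1 1) + a 2 • fderiv ℝ u x (Pi.single 2 1) := fun a => by
    rw [← map_smul, ← map_smul, ← map_smul, ← map_add, ← map_add]
    congr 1
    ext i
    fin_cases i <;> simp
  simp only [ContinuousLinearMap.comp_apply, dot3L_apply, dot3_eq]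
  rw [hdec a, hdec b]
  simp
  linear_combination (a 1 * b 2 - a 2 * b 1) * h0 + (a 2 * b 0 - a 0 * b 2) * h1
    + (a 0 * b 1 - a 1 * b 0) * h2

lemma radial_eq_zero {u : (Fin 3 → ℝ) → (Fin 3 → ℝ)} {φ : (Fin 3 → ℝ) → ℝ}
    (hu : ContinuousOn u (closure (ball3 1)))
    (hd : ∀ x ∈ ball3 1, DifferentiableAt ℝ u x)
    (hφ : ∀ x ∈ ball3 1, HasFDerivAt φ (dot3L (u x)) x)
    (hdiv : ∀ x ∈ ball3 1, div3 u x = 0)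
    (hbc : ∀ x, dot3 x x = 1 → dot3 x (u x) = 0) {x : Fin 3 → ℝ} (hx : x ∈ ball3 1) :
    dot3 x (u x) = 0 := by
  have hball : ∀ {y}, y ∈ ball3 1 ↔ dot3 y y < 1 := by simp [ball3]
  suffices h : ∀ ε > 0, |dot3 x (u x)| ≤ 2 * ε by
    refine abs_nonpos_iff.1 (le_of_forall_pos_le_add fun ε hε => ?_)
    linarith [h (ε / 2) (by positivity)]
  intro ε hε
  obtain ⟨ρ, hρ, hρε⟩ := exists_radial_lt hu hbc hε
  obtain ⟨s, hs, hs1⟩ := exists_between (max_lt hρ (hball.1 hx))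
  obtain ⟨hρs, hxs⟩ := max_lt_iff.1 hs
  have hs0 : 0 ≤ s := (dot3_self_nonneg x).trans hxs.le
  obtain ⟨η, hη, hnear⟩ : ∃ η > 0, ∀ t ∈ Metric.ball (1 : ℝ) η,
      ρ < t ^ 2 * s ∧ t ^ 2 * s < 1 ∧ 1 / 2 < t := by
    have hc : ContinuousAt (fun t : ℝ => t ^ 2 * s) 1 := by fun_prop
    refine Metric.eventually_nhds_iff_ball.1
      ((hc.eventually (lt_mem_nhds (by simpa using hρs))).and
        ((hc.eventually (gt_mem_nhds (by simpa using hs1))).and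
          (lt_mem_nhds (by norm_num))))
  have hscale : ∀ t ∈ Metric.ball (1 : ℝ) η, ∀ y, dot3 y y ≤ s → t • y ∈ ball3 1 := by
    intro t ht y hy
    rw [hball, dot3_smul_smul]
    exact (mul_le_mul_of_nonneg_left hy (sq_nonneg t)).trans_lt (hnear t ht).2.1
  have h1 : (1 : ℝ) ∈ Metric.ball (1 : ℝ) η := Metric.mem_ball_self hη
  have hbdry : ∀ t ∈ Metric.ball (1 : ℝ) η, ∀ y, dot3 y y = s →
      |φ (t • y) - φ y| ≤ 2 * ε * |t - 1| := by
    intro t ht y hy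
    have := (convex_ball (1 : ℝ) η).norm_image_sub_le_of_norm_hasDerivWithin_le
      (f := fun t : ℝ => φ (t • y)) (f' := fun t => dot3 y (u (t • y))) (C := 2 * ε)
      (fun σ hσ => (hasDerivAt_radial (hφ _ (hscale σ hσ y hy.le))).hasDerivWithinAt)
      (fun σ hσ => ?_) h1 ht
    · simpa using this
    · obtain ⟨ha, -, hb⟩ := hnear σ hσ
      have := hρε _ (hscale σ hσ y hy.le) (by rwa [dot3_smul_smul, hy])
      rw [dot3_smul_left, abs_mul, abs_of_pos (by linarith)] at this
      rw [Real.norm_eq_abs]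
      nlinarith [abs_nonneg (dot3 y (u (σ • y)))]
  have hdiv' : ∀ y ∈ ball3 1, ∑ i, fderiv ℝ u y (Pi.single i 1) i = 0 := fun y hy => by
    rw [← hdiv y hy, div3]
    exact Finset.sum_congr rfl fun i _ => (pd_apply (hd y hy) i i).symm
  have hinner : ∀ t ∈ Metric.ball (1 : ℝ) η, |φ (t • x) - φ x| ≤ 2 * ε * |t - 1| := by
    intro t ht
    have hsc : ∀ y, dot3 y y ≤ s → t • y ∈ ball3 1 ∧ y ∈ ball3 1 := fun y hy =>
      ⟨hscale t ht y hy, hball.2 (hy.trans_lt hs1)⟩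
    have hsmul : ∀ y, HasFDerivAt (fun y : Fin 3 → ℝ => t • y)
        (t • ContinuousLinearMap.id ℝ (Fin 3 → ℝ)) y := fun y => (hasFDerivAt_id y).const_smul t
    have hg : ∀ y, dot3 y y ≤ s →
        HasFDerivAt (fun y => φ (t • y) - φ y) (dot3L (t • u (t • y) - u y)) y := fun y hy => by
      refine (((hφ _ (hsc y hy).1).comp y (hsmul y)).sub (hφ _ (hsc y hy).2)).congr_fderiv ?_
      ext1 z
      simp
    refine abs_le_of_div_grad_eq_zero (g := fun y => φ (t • y) - φ y)
      (fun y hy => (hg y hy).continuousAt.continuousWithinAt) (fun y hy => hg y hy.le)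
      (fun y hy => ((((hd _ (hsc y hy.le).1).hasFDerivAt.comp y (hsmul y)).const_smul t).sub
        (hd _ (hsc y hy.le).2).hasFDerivAt)) (fun y hy => ?_) (hbdry t ht) hxs.le
    have e1 := hdiv' _ (hsc y hy.le).1
    have e2 := hdiv' _ (hsc y hy.le).2
    simp [Finset.sum_sub_distrib, ← Finset.mul_sum, e1, e2]
  have hder : HasDerivAt (fun t : ℝ => φ (t • x)) (dot3 x (u x)) 1 :=
    hasDerivAt_radial (by simpa using hφ x hx)
  refine hder.le_of_lip' (by positivity) ?_
  filter_upwards [Metric.ball_mem_nhds _ hη] with t ht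
  simpa using hinner t ht

/-- on the unit ball, a `C¹` field with `rot u = 0`, `div u = 0`
and vanishing normal trace is identically zero (the space of harmonic fields
with vanishing normal trace of a simply connected domain is trivial). -/
theorem harmonic_field_trivial (u : (Fin 3 → ℝ) → (Fin 3 → ℝ))
    (hu : ContDiffOn ℝ 1 u (closure (ball3 1)))
    (hrot : ∀ x ∈ ball3 1, rot3 u x = 0)
    (hdiv : ∀ x ∈ ball3 1, div3 u x = 0)
    (hbc : ∀ x, dot3 x x = 1 ^ 2 → dot3 x (u x) = 0) :
    ∀ x ∈ ball3 1, u x = 0 := by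
  have hd : ∀ x ∈ ball3 1, DifferentiableAt ℝ u x := fun x hx =>
    (hu.differentiableOn one_ne_zero).differentiableAt
      (mem_of_superset ((isOpen_ball3 1).mem_nhds hx) subset_closure)
  obtain ⟨φ, hφ⟩ := exists_potential hd hrot
  have hrad : ∀ x ∈ ball3 1, dot3 x (u x) = 0 := fun x hx =>
    radial_eq_zero hu.continuousOn hd hφ hdiv (by simpa using hbc) hx
  have hscale : ∀ x ∈ ball3 1, ∀ t ∈ Set.Icc (0 : ℝ) 1, t • x ∈ ball3 1 := by
    intro x hx t ht
    simp only [ball3, Set.mem_ofPred_eq, dot3_smul_smul] at hx ⊢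
    nlinarith [dot3_self_nonneg x, pow_le_one₀ ht.1 ht.2 (n := 2)]
  have hconst : ∀ x ∈ ball3 1, φ x = φ 0 := by
    intro x hx
    have hder : ∀ t ∈ Set.Icc (0 : ℝ) 1,
        HasDerivAt (fun t : ℝ => φ (t • x)) (dot3 x (u (t • x))) t :=
      fun t ht => hasDerivAt_radial (hφ _ (hscale x hx t ht))
    obtain ⟨t, ht, h⟩ := exists_hasDerivAt_eq_slope (fun t : ℝ => φ (t • x)) _ one_pos
      (fun t ht => (hder t ht).continuousAt.continuousWithinAt)
      (fun t ht => hder t (Set.Ioo_subset_Icc_self ht))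
    have h0 := hrad _ (hscale x hx t (Set.Ioo_subset_Icc_self ht))
    rw [dot3_smul_left, mul_eq_zero, or_iff_right ht.1.ne'] at h0
    simp [h0] at h
    linarith
  intro x hx
  have hzero : HasFDerivAt φ (0 : (Fin 3 → ℝ) →L[ℝ] ℝ) x :=
    (hasFDerivAt_const (φ 0) x).congr_of_eventuallyEq
      (mem_of_superset ((isOpen_ball3 1).mem_nhds hx) hconst)
  ext i
  simpa [dot3L_apply, dot3, Pi.single_apply] using
    DFunLike.congr_fun ((hφ x hx).unique hzero) (Pi.single i 1)
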